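/- arXiv:math/0505455 — 2 statements merged into one kernel-verified Lean document; each statement's English description precedes it below -/
import Mathlib

section
/- Let p be an odd prime and let h, l be integers with h ≥ l ≥ (p(p+1))². Then the Hadwiger number of the Cartesian product of complete graphs satisfies η(K_h □ K_l) ≥ ⌊h / ((p−1)(2p+1)/2)⌋ · p² · (p−1)(2p+1)/2. -/
open SimpleGraph

/-- `H` is a minor of `G`: there is a family of branch sets in `G`, one for each vertex of `H`,
which are pairwise disjoint, each inducing a connected subgraph of `G`, such that every edge of
`H` is witnessed by an edge of `G` between the corresponding branch sets. -/
def SimpleGraph.IsMinorOf {W V : Type*} (H : SimpleGraph W) (G : SimpleGraph V) : Prop :=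
  ∃ f : W → Set V,
    (∀ w, (G.induce (f w)).Connected) ∧
    (Pairwise fun w w' => Disjoint (f w) (f w')) ∧
    ∀ ⦃w w'⦄, H.Adj w w' → ∃ u ∈ f w, ∃ v ∈ f w', G.Adj u v

/-- The Hadwiger number of `G`: the largest `n` such that `K_n` is a minor of `G`. -/
noncomputable def SimpleGraph.hadwigerNumber {V : Type*} (G : SimpleGraph V) : ℕ :=
  sSup {n : ℕ | (⊤ : SimpleGraph (Fin n)).IsMinorOf G}

namespace SimpleGraph

variable {W W' V V' : Type*}

theorem IsMinorOf.map {H : SimpleGraph W} {G : SimpleGraph V} {G' : SimpleGraph V'}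
    (hH : H.IsMinorOf G) (φ : G ↪g G') : H.IsMinorOf G' := by
  obtain ⟨f, hconn, hdisj, hadj⟩ := hH
  refine ⟨fun w => φ '' f w, fun w => ?_, fun w w' hw => ?_, fun w w' hw => ?_⟩
  · let ψ : G.induce (f w) →g G'.induce (φ '' f w) :=
      ⟨fun x => ⟨φ x, x, x.2, rfl⟩, fun {x y} hxy => by simpa using hxy⟩
    refine (hconn w).map ψ ?_
    rintro ⟨_, x, hx, rfl⟩
    exact ⟨⟨x, hx⟩, rfl⟩
  · exact (Set.disjoint_image_iff φ.injective).2 (hdisj hw)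
  · obtain ⟨u, hu, v, hv, huv⟩ := hadj hw
    exact ⟨φ u, ⟨u, hu, rfl⟩, φ v, ⟨v, hv, rfl⟩, φ.map_adj_iff.2 huv⟩

theorem IsMinorOf.comap {H : SimpleGraph W} {H' : SimpleGraph W'} {G : SimpleGraph V}
    (hH : H.IsMinorOf G) (φ : H' ↪g H) : H'.IsMinorOf G := by
  obtain ⟨f, hconn, hdisj, hadj⟩ := hH
  exact ⟨f ∘ φ, fun w => hconn _, fun w w' hw => hdisj (φ.injective.ne hw),
    fun w w' hw => hadj (φ.map_adj_iff.2 hw)⟩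

theorem IsMinorOf.card_le [Fintype W] [Fintype V] {H : SimpleGraph W} {G : SimpleGraph V}
    (hH : H.IsMinorOf G) : Fintype.card W ≤ Fintype.card V := by
  obtain ⟨f, hconn, hdisj, -⟩ := hH
  choose g hg using fun w => (Set.nonempty_coe_sort.1 (hconn w).nonempty)
  refine Fintype.card_le_of_injective g fun w w' hw => ?_
  by_contra hne
  exact Set.disjoint_left.1 (hdisj hne) (hg w) (hw ▸ hg w')

theorem card_le_hadwigerNumber [Fintype W] [Fintype V] {G : SimpleGraph V}
    (hG : (⊤ : SimpleGraph W).IsMinorOf G) : Fintype.card W ≤ G.hadwigerNumber := by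
  refine le_csSup ⟨Fintype.card V, fun n hn => ?_⟩ ?_
  · simpa using IsMinorOf.card_le hn
  · exact hG.comap (Embedding.completeGraph (Fintype.equivFin W).symm.toEmbedding)

/-- Embeddings of the vertex sets induce an embedding of products of complete graphs. -/
def boxProdTopEmbedding {R R' C C' : Type*} (φ : R ↪ R') (ψ : C ↪ C') :
    boxProd (⊤ : SimpleGraph R) (⊤ : SimpleGraph C) ↪g
      boxProd (⊤ : SimpleGraph R') (⊤ : SimpleGraph C') where
  toEmbedding := φ.prodMap ψ
  map_rel_iff' := by simp [boxProd_adj]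

/-- In a product of complete graphs, disjoint sets that share a row or a column are joined
by an edge. -/
theorem exists_adj_boxProd_top {R C : Type*} {A B : Set (R × C)} (hAB : Disjoint A B)
    {u v : R × C} (hu : u ∈ A) (hv : v ∈ B) (h : u.1 = v.1 ∨ u.2 = v.2) :
    ∃ u ∈ A, ∃ v ∈ B, ((⊤ : SimpleGraph R) □ (⊤ : SimpleGraph C)).Adj u v := by
  refine ⟨u, hu, v, hv, ?_⟩
  have hne : u ≠ v := fun huv => Set.disjoint_left.1 hAB hu (huv ▸ hv)
  rw [Ne, Prod.ext_iff, not_and_or] at hne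
  rw [boxProd_adj, top_adj, top_adj]
  tauto

theorem reachable_induce_boxProd_top {R C : Type*} {A : Set (R × C)}
    {u v : R × C} (hu : u ∈ A) (hv : v ∈ A) (h : u.1 = v.1 ∨ u.2 = v.2) :
    (((⊤ : SimpleGraph R) □ (⊤ : SimpleGraph C)).induce A).Reachable ⟨u, hu⟩ ⟨v, hv⟩ := by
  by_cases huv : u = v
  · subst huv
    rfl
  · refine Adj.reachable ?_
    rw [Prod.ext_iff, not_and_or] at huv
    rw [induce_adj, boxProd_adj, top_adj, top_adj]
    tauto

end SimpleGraph

section Construction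

variable {q a : ℕ} {F : Type*} [Field F]

/-- The columns of the grid: the points of the affine plane over `F`, connecting columns indexed
by an intercept and a colour, and three columns for each parallel class. -/
abbrev Column (q : ℕ) (F : Type*) : Type _ := (F × F) ⊕ (F × Fin 4) ⊕ (ZMod q × ZMod 3)

/-- The branch set of the line with slope `m κ` and intercept `i` in the `r`-th copy of its
parallel class. It consists of the line itself in the row `(κ, r)`, a connecting column that
leads to two further rows, and in each of these a cell in one of the columns of the class `κ`. -/
def branchSet (m : ZMod q → F) (c : ZMod a → Fin 4) (d₁ d₂ : F → ZMod q) (t : F → ZMod 3)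
    (w : (ZMod q × ZMod a) × F) : Set ((ZMod q × ZMod a) × Column q F) := {z |
  match z.2 with
  | .inl (x, y) => z.1 = w.1 ∧ y = m w.1.1 * x + w.2
  | .inr (.inl (j, k)) => j = w.2 ∧ k = c w.1.2 ∧ (z.1 = w.1 ∨
      z.1 = (w.1.1 + d₁ w.2, w.1.2 + 1) ∨ z.1 = (w.1.1 + d₂ w.2, w.1.2 + 2))
  | .inr (.inr (κ, u)) => κ = w.1.1 ∧
      (z.1 = (w.1.1 + d₁ w.2, w.1.2 + 1) ∧ u = t w.2 ∨
        z.1 = (w.1.1 + d₂ w.2, w.1.2 + 2) ∧ u = t w.2 + 1)}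

variable {m : ZMod q → F} {c : ZMod a → Fin 4} {d₁ d₂ : F → ZMod q} {t : F → ZMod 3}

theorem connected_induce_branchSet (w : (ZMod q × ZMod a) × F) :
    (((⊤ : SimpleGraph (ZMod q × ZMod a)) □ (⊤ : SimpleGraph (Column q F))).induce
      (branchSet m c d₁ d₂ t w)).Connected := by
  have hub : (w.1, .inr (.inl (w.2, c w.1.2))) ∈ branchSet m c d₁ d₂ t w := by
    simp [branchSet]
  rw [connected_iff_exists_forall_reachable]
  refine ⟨⟨_, hub⟩, ?_⟩
  rintro ⟨⟨ρ, ⟨x, y⟩ | ⟨j, k⟩ | ⟨κ, u⟩⟩, hz⟩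
  · exact reachable_induce_boxProd_top _ _ (.inl hz.1.symm)
  · exact reachable_induce_boxProd_top _ _ (.inr (by rw [hz.1, hz.2.1]))
  · have hmid : (ρ, .inr (.inl (w.2, c w.1.2))) ∈ branchSet m c d₁ d₂ t w :=
      ⟨rfl, rfl, .inr (hz.2.imp And.left And.left)⟩
    exact (reachable_induce_boxProd_top hub hmid (.inr rfl)).trans
      (reachable_induce_boxProd_top _ _ (.inl rfl))

theorem disjoint_branchSet (hc₁ : ∀ r, c r ≠ c (r + 1)) (hc₂ : ∀ r, c r ≠ c (r + 2))
    (hd₁ : ∀ i j, d₁ i = d₁ j → t i = t j → i = j)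
    (hd₂ : ∀ i j, d₂ i = d₂ j → t i = t j → i = j)
    (hd : ∀ i j, d₁ i ≠ d₂ j) :
    Pairwise fun w w' => Disjoint (branchSet m c d₁ d₂ t w) (branchSet m c d₁ d₂ t w') := by
  rintro ⟨⟨κ, r⟩, i⟩ ⟨⟨κ', r'⟩, i'⟩ hne
  rw [Set.disjoint_left]
  rintro ⟨ρ, ⟨x, y⟩ | ⟨j, k⟩ | ⟨μ, u⟩⟩ h h'
  · obtain ⟨rfl, rfl⟩ := h
    obtain ⟨h₁, h₂⟩ := h'
    obtain ⟨rfl, rfl⟩ := Prod.mk.inj h₁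
    exact hne (by simpa using h₂)
  · obtain ⟨rfl, rfl, h⟩ := h
    obtain ⟨rfl, hk, h'⟩ := h'
    have key : r = r' → κ = κ' → False := by
      rintro rfl rfl
      exact hne rfl
    have hr (s : ZMod a) : s + 2 = s + 1 + 1 := by ring
    simp only [Prod.ext_iff] at h h' hk
    have h1 := hc₁ r
    have h2 := hc₁ r'
    have h3 := hc₂ r
    have h4 := hc₂ r'
    have h5 := hr r
    have h6 := hr r'
    grind
  · obtain ⟨rfl, h⟩ := h
    obtain ⟨rfl, h'⟩ := h'
    simp only [Prod.ext_iff] at h h'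
    have h1 := hd₁ i i'
    have h2 := hd₂ i i'
    have h3 := hd i i'
    have h4 := hd i' i
    grind

theorem isMinorOf_boxProd_top (hm : m.Injective)
    (hc₁ : ∀ r, c r ≠ c (r + 1)) (hc₂ : ∀ r, c r ≠ c (r + 2))
    (hd₁ : ∀ i j, d₁ i = d₁ j → t i = t j → i = j)
    (hd₂ : ∀ i j, d₂ i = d₂ j → t i = t j → i = j)
    (hd : ∀ i j, d₁ i ≠ d₂ j) :
    (⊤ : SimpleGraph ((ZMod q × ZMod a) × F)).IsMinorOf
      ((⊤ : SimpleGraph (ZMod q × ZMod a)) □ (⊤ : SimpleGraph (Column q F))) := by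
  have hdisj := disjoint_branchSet (m := m) hc₁ hc₂ hd₁ hd₂ hd
  refine ⟨branchSet m c d₁ d₂ t, connected_induce_branchSet, hdisj, ?_⟩
  rintro ⟨⟨κ, r⟩, i⟩ ⟨⟨κ', r'⟩, i'⟩ hne
  by_cases hκ : κ = κ'
  · subst hκ
    have h₁ (r : ZMod a) (i : F) : ((κ + d₁ i, r + 1), .inr (.inr (κ, t i))) ∈
        branchSet m c d₁ d₂ t ((κ, r), i) := ⟨rfl, .inl ⟨rfl, rfl⟩⟩
    have h₂ (r : ZMod a) (i : F) : ((κ + d₂ i, r + 2), .inr (.inr (κ, t i + 1))) ∈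
        branchSet m c d₁ d₂ t ((κ, r), i) := ⟨rfl, .inr ⟨rfl, rfl⟩⟩
    have htri : ∀ u v : ZMod 3, u = v ∨ u = v + 1 ∨ u + 1 = v := by decide
    rcases htri (t i) (t i') with h | h | h
    · exact exists_adj_boxProd_top (hdisj hne) (h₁ r i) (h₁ r' i') (.inr (by simp [h]))
    · exact exists_adj_boxProd_top (hdisj hne) (h₁ r i) (h₂ r' i') (.inr (by simp [h]))
    · exact exists_adj_boxProd_top (hdisj hne) (h₂ r i) (h₁ r' i') (.inr (by simp [h]))
  · have hsub : m κ - m κ' ≠ 0 := sub_ne_zero.2 (hm.ne hκ)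
    set x := (i' - i) / (m κ - m κ') with hx
    have hxy : m κ * x + i = m κ' * x + i' := by
      rw [hx]
      field_simp
      ring
    have hmem : ((κ, r), .inl (x, m κ * x + i)) ∈ branchSet m c d₁ d₂ t ((κ, r), i) :=
      ⟨rfl, rfl⟩
    have hmem' : ((κ', r'), .inl (x, m κ * x + i)) ∈ branchSet m c d₁ d₂ t ((κ', r'), i') :=
      ⟨rfl, hxy⟩
    exact exists_adj_boxProd_top (hdisj hne) hmem hmem' (.inr rfl)

end Construction

/-- The square of a cycle of length at least `8` is `4`-colourable. -/
theorem exists_coloring_square_cycle {a : ℕ} (ha : 8 ≤ a) :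
    ∃ c : ZMod a → Fin 4, (∀ r, c r ≠ c (r + 1)) ∧ ∀ r, c r ≠ c (r + 2) := by
  have : NeZero a := ⟨by omega⟩
  have : Fact (1 < a) := ⟨by omega⟩
  let g : ℕ → Fin 4 := fun j =>
    if j < 4 * (a % 3) then ⟨j % 4, by omega⟩ else ⟨(j - 4 * (a % 3)) % 3, by omega⟩
  have h2 : (2 : ZMod a).val = 2 := ZMod.val_natCast_of_lt (n := a) (a := 2) (by omega)
  refine ⟨fun r => g r.val, fun r => ?_, fun r => ?_⟩
  · have hr := r.val_lt
    rcases lt_or_ge (r.val + 1) a with h | h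
    · have : (r + 1).val = r.val + 1 := by rw [ZMod.val_add, ZMod.val_one, Nat.mod_eq_of_lt h]
      simp only [this, g]
      split_ifs <;> simp only [ne_eq, Fin.mk.injEq] <;> omega
    · have : (r + 1).val = r.val + 1 - a := by
        rw [ZMod.val_add, ZMod.val_one, Nat.mod_eq_sub_mod h, Nat.mod_eq_of_lt (by omega)]
      simp only [this, g]
      split_ifs <;> simp only [ne_eq, Fin.mk.injEq] <;> omega
  · have hr := r.val_lt
    rcases lt_or_ge (r.val + 2) a with h | h
    · have : (r + 2).val = r.val + 2 := by rw [ZMod.val_add, h2, Nat.mod_eq_of_lt h]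
      simp only [this, g]
      split_ifs <;> simp only [ne_eq, Fin.mk.injEq] <;> omega
    · have : (r + 2).val = r.val + 2 - a := by
        rw [ZMod.val_add, h2, Nat.mod_eq_sub_mod h, Nat.mod_eq_of_lt (by omega)]
      simp only [this, g]
      split_ifs <;> simp only [ne_eq, Fin.mk.injEq] <;> omega

theorem exists_offsets {q : ℕ} {F : Type*} [Fintype F]
    (hq : 2 * ((Fintype.card F + 2) / 3) ≤ q) :
    ∃ (d₁ d₂ : F → ZMod q) (t : F → ZMod 3), (∀ i j, d₁ i = d₁ j → t i = t j → i = j) ∧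
      (∀ i j, d₂ i = d₂ j → t i = t j → i = j) ∧ ∀ i j, d₁ i ≠ d₂ j := by
  have cast_inj {k l : ℕ} (hk : k < q) (hl : l < q) (h : (k : ZMod q) = l) : k = l :=
    Nat.ModEq.eq_of_lt_of_lt ((ZMod.natCast_eq_natCast_iff _ _ _).1 h) hk hl
  let e : F → ℕ := fun i => Fintype.equivFin F i
  have he (i : F) : e i < Fintype.card F := (Fintype.equivFin F i).2
  have einj {i j : F} (h : e i / 3 = e j / 3) (h' : (e i : ZMod 3) = e j) : i = j := by
    have h' : e i % 3 = e j % 3 := (ZMod.natCast_eq_natCast_iff _ _ _).1 h'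
    exact (Fintype.equivFin F).injective (Fin.ext (show e i = e j by omega))
  refine ⟨fun i => (e i / 3 : ℕ), fun i => ((Fintype.card F + 2) / 3 + e i / 3 : ℕ),
    fun i => (e i : ZMod 3), fun i j h => einj ?_, fun i j h => einj ?_, fun i j h => ?_⟩
  all_goals
    have hi := he i
    have hj := he j
    have := cast_inj (by omega) (by omega) h
    omega

theorem card_mul_card_le_hadwigerNumber {q a h l : ℕ} (F : Type*) [Field F] [Fintype F]
    (ha : 8 ≤ a) (hqF : q ≤ Fintype.card F) (hq : 2 * ((Fintype.card F + 2) / 3) ≤ q)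
    (hh : q * a ≤ h) (hl : Fintype.card F ^ 2 + 4 * Fintype.card F + 3 * q ≤ l) :
    q * a * Fintype.card F ≤
      ((⊤ : SimpleGraph (Fin h)) □ (⊤ : SimpleGraph (Fin l))).hadwigerNumber := by
  have hF : 0 < Fintype.card F := Fintype.card_pos
  have : NeZero q := ⟨by omega⟩
  have : NeZero a := ⟨by omega⟩
  obtain ⟨m⟩ : Nonempty (ZMod q ↪ F) :=
    Function.Embedding.nonempty_of_card_le (by simpa [ZMod.card] using hqF)
  obtain ⟨φ⟩ : Nonempty (ZMod q × ZMod a ↪ Fin h) :=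
    Function.Embedding.nonempty_of_card_le (by simpa [ZMod.card] using hh)
  obtain ⟨ψ⟩ : Nonempty (Column q F ↪ Fin l) := by
    refine Function.Embedding.nonempty_of_card_le ?_
    simp only [Fintype.card_sum, Fintype.card_prod, ZMod.card, Fintype.card_fin]
    linarith
  obtain ⟨c, hc₁, hc₂⟩ := exists_coloring_square_cycle ha
  obtain ⟨d₁, d₂, t, hd₁, hd₂, hd⟩ := exists_offsets hq
  simpa [ZMod.card] using card_le_hadwigerNumber
    ((isMinorOf_boxProd_top m.injective hc₁ hc₂ hd₁ hd₂ hd).map (boxProdTopEmbedding φ ψ))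

theorem stmt_1 (p h l : ℕ) (hp : p.Prime) (hodd : Odd p)
    (hl : (p * (p + 1)) ^ 2 ≤ l) (hlh : l ≤ h) :
    h / ((p - 1) * (2 * p + 1) / 2) * p ^ 2 * ((p - 1) * (2 * p + 1) / 2) ≤
      ((⊤ : SimpleGraph (Fin h)) □ (⊤ : SimpleGraph (Fin l))).hadwigerNumber := by
  have : Fact p.Prime := ⟨hp⟩
  have : Fintype (GaloisField p 2) := Fintype.ofFinite _
  have hF : Fintype.card (GaloisField p 2) = p ^ 2 := by
    rw [Fintype.card_eq_nat_card, GaloisField.card p 2 two_ne_zero]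
  obtain ⟨k, rfl⟩ := hodd
  have hk : 1 ≤ k := by
    by_contra! hk
    obtain rfl : k = 0 := by omega
    exact hp.ne_one rfl
  have hq : (2 * k + 1 - 1) * (2 * (2 * k + 1) + 1) / 2 = 4 * k ^ 2 + 3 * k := by
    rw [Nat.add_sub_cancel, mul_assoc, Nat.mul_div_cancel_left _ two_pos]
    ring
  rw [hq]
  set q := 4 * k ^ 2 + 3 * k with hqdef
  have hpq : (2 * k + 1) ^ 2 = q + k + 1 := by
    rw [hqdef]
    ring
  have hk2 : k ≤ k ^ 2 := Nat.le_self_pow two_ne_zero k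
  have hqk : 7 * k ≤ q := by omega
  have hl' : (q + k + 1) ^ 2 + 4 * (q + k + 1) + 3 * q ≤ l := by
    refine le_trans ?_ hl
    rw [mul_pow, hpq]
    have : (2 * k + 1 + 1) ^ 2 = (q + k + 1) + 4 * k + 3 := by
      rw [hqdef]
      ring
    rw [this]
    nlinarith
  have ha : 8 ≤ h / q := by
    rw [Nat.le_div_iff_mul_le (by omega)]
    nlinarith
  have hhalf : 2 * ((q + k + 1 + 2) / 3) ≤ q := by
    rcases hk.eq_or_lt with rfl | hk
    · simp [hqdef]
    · have : 2 * k ≤ k ^ 2 := by nlinarith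
      omega
  have key := card_mul_card_le_hadwigerNumber (q := q) (h := h) (l := l)
    (GaloisField (2 * k + 1) 2) ha (by omega) (by rwa [hF, hpq]) (Nat.mul_div_le h q)
    (by rwa [hF, hpq])
  rwa [hF, mul_comm q, mul_right_comm] at key
end

section
/- For any two finite simple graphs G₁ and G₂, each with at least one vertex, the chromatic number of their Cartesian product satisfies χ(G₁ □ G₂) = max{χ(G₁), χ(G₂)}. -/
open SimpleGraph

theorem SimpleGraph.Colorable.boxProd {α β : Type*} {G : SimpleGraph α} {H : SimpleGraph β}
    {n : ℕ} (hG : G.Colorable n) (hH : H.Colorable n) : (G □ H).Colorable n := by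
  obtain ⟨C⟩ := hG
  obtain ⟨D⟩ := hH
  refine ⟨Coloring.mk (fun v => C v.1 + D v.2) ?_⟩
  rintro ⟨a, b⟩ ⟨a', b'⟩ h heq
  have : NeZero n := ⟨(C a).pos.ne'⟩
  rcases boxProd_adj.1 h with ⟨hadj, hb⟩ | ⟨hadj, ha⟩
  · obtain rfl : b = b' := hb
    exact C.valid hadj (add_right_cancel heq)
  · obtain rfl : a = a' := ha
    exact D.valid hadj (add_left_cancel heq)

theorem SimpleGraph.chromaticNumber_boxProd {α β : Type*} [Nonempty α] [Nonempty β]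
    (G : SimpleGraph α) (H : SimpleGraph β) :
    (G □ H).chromaticNumber = max G.chromaticNumber H.chromaticNumber := by
  apply le_antisymm
  · induction hm : max G.chromaticNumber H.chromaticNumber using ENat.recTopCoe with
    | top => exact le_top
    | coe n =>
      obtain ⟨hG, hH⟩ := max_le_iff.1 hm.le
      exact ((chromaticNumber_le_iff_colorable.1 hG).boxProd
        (chromaticNumber_le_iff_colorable.1 hH)).chromaticNumber_le
  · exact max_le
      (chromaticNumber_mono_of_hom (G.boxProdLeft H (Classical.arbitrary β)).toHom)
      (chromaticNumber_mono_of_hom (G.boxProdRight H (Classical.arbitrary α)).toHom)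

theorem stmt_14 (V₁ V₂ : Type) [Fintype V₁] [Fintype V₂] [Nonempty V₁] [Nonempty V₂]
    (G₁ : SimpleGraph V₁) (G₂ : SimpleGraph V₂) :
    (G₁ □ G₂).chromaticNumber = max G₁.chromaticNumber G₂.chromaticNumber := by
  exact chromaticNumber_boxProd G₁ G₂
end
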